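/- The number of (a_1,…,a_k,S)-derangements equals (1/(a_1!⋯a_k!)) Σ_{π ∈ S_n} c_S(π), where c_S(π) = 0 if π has a small cycle in an ascending block or an odd-length small cycle, and c_S(π) = 2^m otherwise, with m the number of small cycles of π. -/

import Mathlib

/-- Apply a permutation of `Fin n` to a natural number (0-based indexing);
indices `≥ n` are left fixed. -/
def appl {n : ℕ} (π : Equiv.Perm (Fin n)) (j : ℕ) : ℕ :=
  if h : j < n then ((π ⟨j, h⟩ : Fin n) : ℕ) else j

/-- The starting index (0-based) of the `i`-th consecutive block when
`{0,…,n-1}` is partitioned into blocks of sizes `a 0, …, a (k-1)`. -/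
def blockStart {k : ℕ} (a : Fin k → ℕ) (i : Fin k) : ℕ := ∑ t ∈ Finset.Iio i, a t

/-- `x` lies in the `i`-th block. -/
def inBlock {k : ℕ} (a : Fin k → ℕ) (i : Fin k) (x : ℕ) : Prop :=
  blockStart a i ≤ x ∧ x < blockStart a i + a i

instance {k : ℕ} (a : Fin k → ℕ) (i : Fin k) : DecidablePred (inBlock a i) := fun x =>
  inferInstanceAs (Decidable (blockStart a i ≤ x ∧ x < blockStart a i + a i))

/-- An `(a₁,…,a_k,S)`-permutation: a permutation of `{0,…,n-1}` (where `n = ∑ aᵢ`)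
that is strictly decreasing on each block `Aᵢ` with `i ∈ S` and strictly
increasing on each block `Aᵢ` with `i ∉ S`. -/
def IsASPerm {k : ℕ} (a : Fin k → ℕ) (S : Finset (Fin k))
    (π : Equiv.Perm (Fin (∑ t, a t))) : Prop :=
  ∀ i : Fin k, ∀ j : ℕ, blockStart a i ≤ j → j + 1 < blockStart a i + a i →
    if i ∈ S then appl π (j + 1) < appl π j else appl π j < appl π (j + 1)

/-- The number of `(a,S)`-derangements. -/
noncomputable def numDer (k : ℕ) (a : Fin k → ℕ) (S : Finset (Fin k)) : ℕ :=
  Nat.card {π : Equiv.Perm (Fin (∑ t, a t)) // IsASPerm a S π ∧ ∀ x, π x ≠ x}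

/-- The small cycles of `π` of length `≥ 2`. -/
def smallCycles {k : ℕ} (a : Fin k → ℕ) (π : Equiv.Perm (Fin (∑ t, a t))) :
    Finset (Equiv.Perm (Fin (∑ t, a t))) :=
  π.cycleFactorsFinset.filter (fun c => ∃ i, ∀ x ∈ c.support, inBlock a i (x : ℕ))

/-- `c_S(π)`: zero if `π` has a small cycle in an ascending block or an
odd-length small cycle (a fixed point being an odd small cycle), and `2^m`
otherwise, with `m` the number of small cycles of `π`. -/
def cSWeight {k : ℕ} (a : Fin k → ℕ) (S : Finset (Fin k))
    (π : Equiv.Perm (Fin (∑ t, a t))) : ℕ :=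
  if (∃ x, π x = x) ∨
      ∃ c ∈ smallCycles a π,
        Odd c.support.card ∨ ∃ i ∉ S, ∀ x ∈ c.support, inBlock a i (x : ℕ) then 0
  else 2 ^ (smallCycles a π).card

section Words

variable {κ : Type*} [LinearOrder κ]

/-- A cut of a word into `u` and `v` is balanced for the letter `i` if a letter `i` put at the cut
becomes a fixed point of the permutation encoded by the word: for a descending letter (`i ∈ S`) as
many letters `≥ i` precede the cut as letters `≤ i` follow it, and for an ascending letter the same
holds with strict inequalities. -/
def BalancedCut (S : Finset κ) (i : κ) (u v : List κ) : Prop :=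
  if i ∈ S then u.countP (i ≤ ·) = v.countP (· ≤ i) else u.countP (i < ·) = v.countP (· < i)

/-- Some occurrence of `i` in the word `l` encodes a fixed point. -/
def HasFixedLetter (S : Finset κ) (i : κ) (l : List κ) : Prop :=
  ∃ u v, l = u ++ i :: v ∧ BalancedCut S i u v

/-- The word `l` arises from `l'` by inserting the letter `i` at a balanced cut. -/
def IsInsertion (S : Finset κ) (i : κ) (l' l : List κ) : Prop :=
  ∃ u v, l' = u ++ v ∧ l = u ++ i :: v ∧ BalancedCut S i u v

lemma hasFixedLetter_iff_exists_isInsertion {S : Finset κ} {i : κ} {l : List κ} :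
    HasFixedLetter S i l ↔ ∃ l', IsInsertion S i l' l := by
  constructor
  · rintro ⟨u, v, rfl, h⟩
    exact ⟨u ++ v, u, v, rfl, rfl, h⟩
  · rintro ⟨l', u, v, rfl, rfl, h⟩
    exact ⟨u, v, rfl, h⟩

lemma eq_replicate_of_countP_eq_zero {i : κ} {w : List κ} (h₁ : w.countP (i < ·) = 0)
    (h₂ : w.countP (· < i) = 0) : w = List.replicate w.length i := by
  rw [List.eq_replicate_iff]
  refine ⟨rfl, fun x hx => ?_⟩
  rw [List.countP_eq_zero] at h₁ h₂
  have := h₁ x hx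
  have := h₂ x hx
  simp only [decide_eq_true_eq, not_lt] at *
  order

lemma eq_nil_of_countP_eq_zero {i : κ} {w : List κ} (h₁ : w.countP (i ≤ ·) = 0)
    (h₂ : w.countP (· ≤ i) = 0) : w = [] := by
  rw [List.eq_nil_iff_forall_not_mem]
  intro x hx
  rw [List.countP_eq_zero] at h₁ h₂
  have := h₁ x hx
  have := h₂ x hx
  simp only [decide_eq_true_eq, not_le] at *
  order

lemma cons_append_eq_append_cons_of_countP_eq_zero {i : κ} {w : List κ}
    (h₁ : w.countP (i < ·) = 0) (h₂ : w.countP (· < i) = 0) (v : List κ) :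
    i :: (w ++ v) = w ++ i :: v := by
  rw [eq_replicate_of_countP_eq_zero h₁ h₂, ← List.cons_append, ← List.replicate_succ,
    List.replicate_succ', List.append_assoc, List.singleton_append]

lemma exists_balanced_cut {S : Finset κ} {i : κ} (hi : i ∉ S)
    {u v : List κ} (h : u.countP (i < ·) ≤ v.countP (· < i)) :
    ∃ u' v', u ++ v = u' ++ v' ∧ BalancedCut S i u' v' := by
  simp only [BalancedCut, hi, if_false]
  induction v generalizing u with
  | nil => exact ⟨u, [], rfl, by simpa using h⟩
  | cons j v ih =>
    by_cases he : u.countP (i < ·) = (j :: v).countP (· < i)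
    · exact ⟨u, _, rfl, he⟩
    · obtain ⟨u', v', h', hb⟩ := @ih (u ++ [j]) (by
        rcases lt_trichotomy i j with hj | hj | hj <;>
          simp [hj, hj.not_gt] at h he ⊢ <;> omega)
      exact ⟨u', v', by simpa using h', hb⟩

lemma insertion_unique {S : Finset κ} {i : κ} (hi : i ∉ S)
    {u v u' v' : List κ} (h : u ++ v = u' ++ v') (hb : BalancedCut S i u v)
    (hb' : BalancedCut S i u' v') : u ++ i :: v = u' ++ i :: v' := by
  simp only [BalancedCut, hi, if_false] at hb hb'
  rcases List.append_eq_append_iff.1 h with ⟨w, rfl, rfl⟩ | ⟨w, rfl, rfl⟩ <;>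
  · simp only [List.countP_append] at hb hb'
    rw [cons_append_eq_append_cons_of_countP_eq_zero (by omega) (by omega)]
    simp

lemma removal_unique {S : Finset κ} {i : κ} (hi : i ∉ S)
    {u v u' v' : List κ} (h : u ++ i :: v = u' ++ i :: v')
    (hb : BalancedCut S i u v) (hb' : BalancedCut S i u' v') : u ++ v = u' ++ v' := by
  simp only [BalancedCut, hi, if_false] at hb hb'
  rcases List.append_eq_append_iff.1 h with ⟨w, rfl, h'⟩ | ⟨w, rfl, h'⟩ <;>
  · rcases List.cons_eq_append_iff.1 h' with ⟨rfl, h'⟩ | ⟨w, rfl, rfl⟩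
    · simp_all
    · simp only [List.countP_append, List.countP_cons, lt_self_iff_false, decide_false,
        Bool.false_eq_true, if_false] at hb hb'
      simp [← cons_append_eq_append_cons_of_countP_eq_zero (i := i) (w := w) (by omega) (by omega)]

lemma exists_balanced_cut_or_hasFixedLetter {S : Finset κ} {i : κ} (hi : i ∈ S)
    {u v : List κ}
    (h : u.countP (i ≤ ·) ≤ v.countP (· ≤ i)) :
    (∃ u' v', u ++ v = u' ++ v' ∧ BalancedCut S i u' v') ∨ HasFixedLetter S i (u ++ v) := by
  simp only [HasFixedLetter, BalancedCut, hi, if_true]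
  induction v generalizing u with
  | nil => exact Or.inl ⟨u, [], rfl, by simpa using h⟩
  | cons j v ih =>
    by_cases he : u.countP (i ≤ ·) = (j :: v).countP (· ≤ i)
    · exact Or.inl ⟨u, _, rfl, he⟩
    by_cases hf : j = i ∧ u.countP (i ≤ ·) = v.countP (· ≤ i)
    · obtain ⟨rfl, hf⟩ := hf
      exact Or.inr ⟨u, v, rfl, hf⟩
    · have := @ih (u ++ [j]) (by
        rcases lt_trichotomy i j with hj | hj | hj
        · simp [hj.le, hj.not_ge] at h he ⊢
          omega
        · subst hj
          simp at h he hf ⊢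
          omega
        · simp [hj.le, hj.not_ge] at h he ⊢
          omega)
      simpa using this

lemma balanced_cut_unique {S : Finset κ} {i : κ} (hi : i ∈ S)
    {u v u' v' : List κ} (h : u ++ v = u' ++ v') (hb : BalancedCut S i u v)
    (hb' : BalancedCut S i u' v') : u = u' ∧ v = v' := by
  simp only [BalancedCut, hi, if_true] at hb hb'
  rcases List.append_eq_append_iff.1 h with ⟨w, rfl, rfl⟩ | ⟨w, rfl, rfl⟩ <;>
  · simp only [List.countP_append] at hb hb'
    rw [eq_nil_of_countP_eq_zero (i := i) (w := w) (by omega) (by omega)]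
    simp

lemma fixed_letter_unique {S : Finset κ} {i : κ} (hi : i ∈ S)
    {u v u' v' : List κ} (h : u ++ i :: v = u' ++ i :: v')
    (hb : BalancedCut S i u v) (hb' : BalancedCut S i u' v') : u = u' ∧ v = v' := by
  simp only [BalancedCut, hi, if_true] at hb hb'
  rcases List.append_eq_append_iff.1 h with ⟨w, rfl, h'⟩ | ⟨w, rfl, h'⟩ <;>
  · rcases List.cons_eq_append_iff.1 h' with ⟨rfl, h'⟩ | ⟨w, rfl, rfl⟩
    · simp_all
    · simp only [List.countP_append, List.countP_cons, le_refl, decide_true, if_true] at hb hb'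
      omega

lemma not_hasFixedLetter_of_balanced {S : Finset κ} {i : κ} (hi : i ∈ S)
    {u v : List κ} (hb : BalancedCut S i u v) :
    ¬ HasFixedLetter S i (u ++ v) := by
  rintro ⟨p, q, h, hb'⟩
  simp only [BalancedCut, hi, if_true] at hb hb'
  rcases List.append_eq_append_iff.1 h with ⟨w, rfl, rfl⟩ | ⟨w, rfl, h'⟩
  · simp only [List.countP_append, List.countP_cons, le_refl, decide_true, if_true] at hb hb'
    omega
  · rcases List.cons_eq_append_iff.1 h' with ⟨rfl, rfl⟩ | ⟨w, rfl, rfl⟩ <;>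
    · simp only [List.countP_append, List.countP_cons, le_refl, decide_true, if_true,
        List.countP_nil] at hb hb'
      omega

lemma BalancedCut.countP_lt_le {S : Finset κ} {i : κ} {u v : List κ} (h : BalancedCut S i u v) :
    u.countP (i < ·) ≤ v.countP (· ≤ i) := by
  have h₁ : u.countP (i < ·) ≤ u.countP (i ≤ ·) :=
    List.countP_mono_left fun x _ hx => by simp at hx ⊢; exact hx.le
  have h₂ : v.countP (· < i) ≤ v.countP (· ≤ i) :=
    List.countP_mono_left fun x _ hx => by simp at hx ⊢; exact hx.le
  unfold BalancedCut at h
  split_ifs at h <;> omega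

lemma BalancedCut.countP_lt_le' {S : Finset κ} {i : κ} {u v : List κ} (h : BalancedCut S i u v) :
    v.countP (· < i) ≤ u.countP (i ≤ ·) := by
  have h₁ : u.countP (i < ·) ≤ u.countP (i ≤ ·) :=
    List.countP_mono_left fun x _ hx => by simp at hx ⊢; exact hx.le
  have h₂ : v.countP (· < i) ≤ v.countP (· ≤ i) :=
    List.countP_mono_left fun x _ hx => by simp at hx ⊢; exact hx.le
  unfold BalancedCut at h
  split_ifs at h <;> omega

lemma BalancedCut.not_balanced_of_lt {S : Finset κ} {i j : κ} (hij : j < i) {u w p q : List κ}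
    (hi : BalancedCut S i u (w ++ j :: q)) : ¬ BalancedCut S j (u ++ p) q := by
  intro hj
  have h₁ := hi.countP_lt_le'
  have h₂ := hj.countP_lt_le
  have h₃ : u.countP (i ≤ ·) ≤ u.countP (j < ·) :=
    List.countP_mono_left fun x _ hx => by simp at hx ⊢; order
  have h₄ : q.countP (· ≤ j) ≤ q.countP (· < i) :=
    List.countP_mono_left fun x _ hx => by simp at hx ⊢; order
  simp only [List.countP_append, List.countP_cons, hij, decide_true, if_true] at h₁ h₂
  omega

lemma BalancedCut.not_balanced_of_gt {S : Finset κ} {i j : κ} (hij : i < j) {p w v q : List κ}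
    (hi : BalancedCut S i (p ++ j :: w) v) : ¬ BalancedCut S j p (q ++ v) := by
  intro hj
  have h₁ := hi.countP_lt_le
  have h₂ := hj.countP_lt_le'
  have h₃ : p.countP (j ≤ ·) ≤ p.countP (i < ·) :=
    List.countP_mono_left fun x _ hx => by simp at hx ⊢; order
  have h₄ : v.countP (· ≤ i) ≤ v.countP (· < j) :=
    List.countP_mono_left fun x _ hx => by simp at hx ⊢; order
  simp only [List.countP_append, List.countP_cons, hij, decide_true, if_true] at h₁ h₂
  omega

lemma balanced_insert_left_iff {S : Finset κ} {i j : κ} (hij : i < j) (u w v : List κ) :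
    BalancedCut S j (u ++ i :: w) v ↔ BalancedCut S j (u ++ w) v := by
  simp [BalancedCut, hij.not_ge, hij.not_gt]

lemma balanced_insert_right_iff {S : Finset κ} {i j : κ} (hij : j < i) (u w v : List κ) :
    BalancedCut S j u (w ++ i :: v) ↔ BalancedCut S j u (w ++ v) := by
  simp [BalancedCut, hij.not_ge, hij.not_gt]

lemma IsInsertion.hasFixedLetter_iff {S : Finset κ} {i j : κ} (hij : j ≠ i) {l' l : List κ}
    (h : IsInsertion S i l' l) : HasFixedLetter S j l' ↔ HasFixedLetter S j l := by
  obtain ⟨u, v, rfl, rfl, hb⟩ := h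
  constructor
  · rintro ⟨p, q, h, hj⟩
    rcases List.append_eq_append_iff.1 h with ⟨w, rfl, rfl⟩ | ⟨w, rfl, h'⟩
    · rcases hij.lt_or_gt with hlt | hlt
      · exact absurd hj (hb.not_balanced_of_lt hlt)
      · exact ⟨u ++ i :: w, q, by simp, (balanced_insert_left_iff hlt _ _ _).2 hj⟩
    · rcases List.cons_eq_append_iff.1 h' with ⟨rfl, rfl⟩ | ⟨w, rfl, rfl⟩
      · rcases hij.lt_or_gt with hlt | hlt
        · refine absurd hj ?_
          simpa using hb.not_balanced_of_lt (w := []) (p := []) hlt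
        · exact ⟨p ++ [i], q, by simp, (balanced_insert_left_iff hlt _ _ _).2 (by simpa using hj)⟩
      · rcases hij.lt_or_gt with hlt | hlt
        · exact ⟨p, w ++ i :: v, by simp, (balanced_insert_right_iff hlt _ _ _).2 hj⟩
        · exact absurd hj (hb.not_balanced_of_gt hlt)
  · rintro ⟨p, q, h, hj⟩
    rcases List.append_eq_append_iff.1 h with ⟨w, rfl, h'⟩ | ⟨w, rfl, h'⟩
    · rcases List.cons_eq_append_iff.1 h' with ⟨rfl, h'⟩ | ⟨w, rfl, rfl⟩
      · simp_all
      · rcases hij.lt_or_gt with hlt | hlt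
        · exact absurd hj (hb.not_balanced_of_lt hlt)
        · exact ⟨u ++ w, q, by simp, (balanced_insert_left_iff hlt _ _ _).1 hj⟩
    · rcases List.cons_eq_append_iff.1 h' with ⟨rfl, h'⟩ | ⟨w, rfl, rfl⟩
      · simp_all
      · rcases hij.lt_or_gt with hlt | hlt
        · exact ⟨p, w ++ v, by simp, (balanced_insert_right_iff hlt _ _ _).1 hj⟩
        · exact absurd (by simpa using hj)
            (hb.not_balanced_of_gt (q := w ++ [i]) hlt)

end Words

section Counting

lemma Set.ncard_eq_of_rel {α β : Type*} {s : Set α} {t : Set β} (r : α → β → Prop)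
    (hs : ∀ x ∈ s, ∃ y ∈ t, r x y) (ht : ∀ y ∈ t, ∃ x ∈ s, r x y)
    (hl : ∀ x x' y, r x y → r x' y → x = x') (hr : ∀ x ∈ s, ∀ y y', r x y → r x y' → y = y') :
    s.ncard = t.ncard := by
  choose f hf using hs
  refine Set.ncard_congr f (fun x hx => (hf x hx).1) (fun x x' hx hx' h => ?_) fun y hy => ?_
  · exact hl _ _ _ (hf x hx).2 (h ▸ (hf x' hx').2)
  · obtain ⟨x, hx, hxy⟩ := ht y hy
    exact ⟨x, hx, hr x hx _ _ (hf x hx).2 hxy⟩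

variable {κ : Type*} [LinearOrder κ]

/-- The words with content `a` in which no letter from `T` has a fixed occurrence. -/
def wordsAvoiding (S T : Finset κ) (a : κ →₀ ℕ) : Set (List κ) :=
  {l | (∀ i, l.count i = a i) ∧ ∀ i ∈ T, ¬ HasFixedLetter S i l}

lemma length_of_mem_wordsAvoiding [Fintype κ] {S T : Finset κ} {a : κ →₀ ℕ} {l : List κ}
    (hl : l ∈ wordsAvoiding S T a) : l.length = ∑ i, a i := by
  rw [← Multiset.coe_card, ← Multiset.sum_count_eq_card (s := Finset.univ) (by simp)]
  simp [hl.1]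

lemma finite_wordsAvoiding [Fintype κ] (S T : Finset κ) (a : κ →₀ ℕ) :
    (wordsAvoiding S T a).Finite :=
  (List.finite_length_eq κ (∑ i, a i)).subset fun _ hl => length_of_mem_wordsAvoiding hl

lemma IsInsertion.count_eq {S : Finset κ} {i : κ} {l' l : List κ} (h : IsInsertion S i l' l)
    (j : κ) : l.count j = l'.count j + Finsupp.single i 1 j := by
  obtain ⟨u, v, rfl, rfl, -⟩ := h
  simp [List.count_cons, Finsupp.single_apply, add_assoc]

lemma ncard_wordsAvoiding_eq_add [Fintype κ] {S T : Finset κ} {i : κ} (a : κ →₀ ℕ) :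
    (wordsAvoiding S T a).ncard = (wordsAvoiding S (insert i T) a).ncard +
      {l ∈ wordsAvoiding S T a | HasFixedLetter S i l}.ncard := by
  rw [← Set.ncard_union_eq ?_ (finite_wordsAvoiding _ _ _)
    ((finite_wordsAvoiding _ _ _).subset (Set.sep_subset _ _))]
  · congr 1
    ext l
    simp only [wordsAvoiding, Finset.mem_insert, forall_eq_or_imp, Set.mem_union, Set.mem_ofPred_eq]
    tauto
  · rw [Set.disjoint_left]
    exact fun l hl hl' => hl.2 i (Finset.mem_insert_self i T) hl'.2

lemma ncard_wordsAvoiding_hasFixedLetter_of_not_le {S T : Finset κ} {i : κ} {a : κ →₀ ℕ}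
    (ha : ¬ Finsupp.single i 1 ≤ a) :
    {l ∈ wordsAvoiding S T a | HasFixedLetter S i l}.ncard = 0 := by
  convert Set.ncard_empty (List κ)
  rw [Set.eq_empty_iff_forall_notMem]
  rintro l ⟨hl, u, v, rfl, -⟩
  have := hl.1 i
  simp only [Finsupp.single_le_iff, List.count_append, List.count_cons_self] at ha this
  omega

lemma mem_wordsAvoiding_of_isInsertion {S T : Finset κ} {i : κ} (hT : i ∉ T) {a : κ →₀ ℕ}
    (ha : Finsupp.single i 1 ≤ a) {l' l : List κ} (h : IsInsertion S i l' l) :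
    l' ∈ wordsAvoiding S T (a - Finsupp.single i 1) ↔ l ∈ wordsAvoiding S T a := by
  refine and_congr (forall_congr' fun j => ?_) (forall₂_congr fun j hj => ?_)
  · have := h.count_eq j
    have := ha j
    rw [Finsupp.coe_tsub, Pi.sub_apply]
    omega
  · rw [h.hasFixedLetter_iff (by rintro rfl; exact hT hj)]

lemma ncard_wordsAvoiding_of_notMem {S T : Finset κ} {i : κ} (hS : i ∉ S) (hT : i ∉ T)
    {a : κ →₀ ℕ} (ha : Finsupp.single i 1 ≤ a) :
    {l ∈ wordsAvoiding S T a | HasFixedLetter S i l}.ncard =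
      (wordsAvoiding S T (a - Finsupp.single i 1)).ncard := by
  symm
  refine Set.ncard_eq_of_rel (IsInsertion S i) (fun l' hl' => ?_) (fun l hl => ?_) ?_ ?_
  · obtain ⟨u, v, rfl, hb⟩ := exists_balanced_cut hS (u := []) (v := l') (by simp)
    have h : IsInsertion S i (u ++ v) (u ++ i :: v) := ⟨u, v, rfl, rfl, hb⟩
    exact ⟨_, ⟨(mem_wordsAvoiding_of_isInsertion hT ha h).1 hl', u, v, rfl, hb⟩, h⟩
  · obtain ⟨l', hl'⟩ := hasFixedLetter_iff_exists_isInsertion.1 hl.2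
    exact ⟨l', (mem_wordsAvoiding_of_isInsertion hT ha hl').2 hl.1, hl'⟩
  · rintro x x' y ⟨u, v, rfl, rfl, hb⟩ ⟨u', v', rfl, h, hb'⟩
    exact removal_unique hS h hb hb'
  · rintro x - y y' ⟨u, v, rfl, rfl, hb⟩ ⟨u', v', h, rfl, hb'⟩
    exact insertion_unique hS h hb hb'

lemma ncard_wordsAvoiding_of_mem {S T : Finset κ} {i : κ} (hS : i ∈ S) (hT : i ∉ T)
    {a : κ →₀ ℕ} (ha : Finsupp.single i 1 ≤ a) :
    {l ∈ wordsAvoiding S T a | HasFixedLetter S i l}.ncard =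
      (wordsAvoiding S (insert i T) (a - Finsupp.single i 1)).ncard := by
  symm
  refine Set.ncard_eq_of_rel (IsInsertion S i) (fun l' hl' => ?_) (fun l hl => ?_) ?_ ?_
  · obtain ⟨u, v, rfl, hb⟩ := (exists_balanced_cut_or_hasFixedLetter hS (u := []) (v := l')
      (by simp)).resolve_right (hl'.2 i (Finset.mem_insert_self i T))
    have h : IsInsertion S i (u ++ v) (u ++ i :: v) := ⟨u, v, rfl, rfl, hb⟩
    refine ⟨_, ⟨(mem_wordsAvoiding_of_isInsertion hT ha h).1 ⟨hl'.1, ?_⟩, u, v, rfl, hb⟩, h⟩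
    exact fun j hj => hl'.2 j (Finset.mem_insert_of_mem hj)
  · obtain ⟨l', hl'⟩ := hasFixedLetter_iff_exists_isInsertion.1 hl.2
    have h := (mem_wordsAvoiding_of_isInsertion hT ha hl').2 hl.1
    refine ⟨l', ⟨h.1, ?_⟩, hl'⟩
    rw [Finset.forall_mem_insert]
    refine ⟨?_, h.2⟩
    obtain ⟨u, v, rfl, -, hb⟩ := hl'
    exact not_hasFixedLetter_of_balanced hS hb
  · rintro x x' y ⟨u, v, rfl, rfl, hb⟩ ⟨u', v', rfl, h, hb'⟩
    obtain ⟨rfl, rfl⟩ := fixed_letter_unique hS h hb hb'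
    rfl
  · rintro x - y y' ⟨u, v, rfl, rfl, hb⟩ ⟨u', v', h, rfl, hb'⟩
    obtain ⟨rfl, rfl⟩ := balanced_cut_unique hS h hb hb'
    rfl

lemma prod_factorial_sub_single [Fintype κ] {a : κ →₀ ℕ} {i : κ} (hi : a i ≠ 0) :
    ∏ j, (a j).factorial = a i * ∏ j, ((a - Finsupp.single i 1 : κ →₀ ℕ) j).factorial := by
  rw [← Finset.mul_prod_erase _ _ (Finset.mem_univ i),
    ← Finset.mul_prod_erase _ (fun j => ((a - Finsupp.single i 1 : κ →₀ ℕ) j).factorial)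
      (Finset.mem_univ i), ← mul_assoc]
  congr 1
  · simp [Nat.mul_factorial_pred hi]
  · refine Finset.prod_congr rfl fun j hj => ?_
    simp [(Finset.ne_of_mem_erase hj).symm]

lemma sum_sub_single [Fintype κ] {a : κ →₀ ℕ} {i : κ} (hi : a i ≠ 0) :
    ∑ j, (a - Finsupp.single i 1 : κ →₀ ℕ) j + 1 = ∑ j, a j := by
  have h : Finsupp.single i 1 ≤ a := by
    rw [Finsupp.single_le_iff]
    omega
  conv_rhs => rw [← tsub_add_cancel_of_le h]
  simp [Finset.sum_add_distrib, Finsupp.single_apply]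

/-- The number of words with a given content is a multinomial coefficient. -/
lemma ncard_wordsAvoiding_empty [Fintype κ] (S : Finset κ) (a : κ →₀ ℕ) :
    (wordsAvoiding S ∅ a).ncard * ∏ i, (a i).factorial = (∑ i, a i).factorial := by
  induction hn : ∑ i, a i generalizing a with
  | zero =>
    have ha : a = 0 := by
      ext i
      simpa using (Finset.sum_eq_zero_iff.1 hn) i (Finset.mem_univ i)
    subst ha
    have : wordsAvoiding S ∅ (0 : κ →₀ ℕ) = {[]} := by
      ext l
      constructor
      · intro hl
        exact List.length_eq_zero_iff.1 (by simpa using length_of_mem_wordsAvoiding hl)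
      · rintro rfl
        simp [wordsAvoiding]
    simp [this]
  | succ n ih =>
    let f : (Σ i, {l // i :: l ∈ wordsAvoiding S ∅ a}) → wordsAvoiding S ∅ a :=
      fun x => ⟨x.1 :: x.2.1, x.2.2⟩
    have hf : f.Bijective := by
      constructor
      · rintro ⟨i, l, hl⟩ ⟨j, l', hl'⟩ h
        simp only [f, Subtype.mk.injEq, List.cons.injEq] at h
        obtain ⟨rfl, rfl⟩ := h
        rfl
      · rintro ⟨_ | ⟨i, l⟩, hl⟩
        · have := length_of_mem_wordsAvoiding hl
          simp [hn] at this
        · exact ⟨⟨i, l, hl⟩, rfl⟩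
    have (i : κ) : Finite {l // i :: l ∈ wordsAvoiding S ∅ a} :=
      ((finite_wordsAvoiding S ∅ a).preimage (List.cons_injective.injOn (s := _)))
    rw [← Nat.card_coe_set_eq, ← Nat.card_congr (Equiv.ofBijective f hf), Nat.card_sigma,
      Finset.sum_mul, Nat.factorial_succ, ← hn, Finset.sum_mul]
    refine Finset.sum_congr rfl fun i _ => ?_
    by_cases hi : a i = 0
    · have : IsEmpty {l // i :: l ∈ wordsAvoiding S ∅ a} := by
        refine ⟨fun l => ?_⟩
        have := l.2.1 i
        simp [hi] at this
      simp [hi]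
    · have : {l | i :: l ∈ wordsAvoiding S ∅ a} =
          wordsAvoiding S ∅ (a - Finsupp.single i 1) := by
        ext l
        simp only [wordsAvoiding, Finset.notMem_empty, false_imp_iff, implies_true, and_true,
          Set.mem_ofPred_eq, Finsupp.coe_tsub, Pi.sub_apply, List.count_cons, beq_iff_eq,
          Finsupp.single_apply]
        refine forall_congr' fun j => ?_
        split_ifs with h
        · subst h
          omega
        · omega
      have hs := sum_sub_single hi
      rw [prod_factorial_sub_single hi, mul_left_comm]
      congr 1
      rw [← ih (a - Finsupp.single i 1) (by omega), ← this, ← Nat.card_coe_set_eq]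
      rfl

open MvPowerSeries

/-- The generating function of the words avoiding fixed occurrences of letters from `T`. -/
noncomputable def wordSeries (S T : Finset κ) : MvPowerSeries κ ℚ :=
  fun a => (wordsAvoiding S T a).ncard

lemma coeff_wordSeries (S T : Finset κ) (a : κ →₀ ℕ) :
    coeff a (wordSeries S T) = (wordsAvoiding S T a).ncard := rfl

lemma wordSeries_insert_of_notMem [Fintype κ] {S T : Finset κ} {i : κ} (hS : i ∉ S)
    (hT : i ∉ T) : wordSeries S T = wordSeries S (insert i T) + X i * wordSeries S T := by
  ext a
  rw [map_add, X, coeff_monomial_mul, coeff_wordSeries, ncard_wordsAvoiding_eq_add (i := i)]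
  split_ifs with ha
  · simp [coeff_wordSeries, ncard_wordsAvoiding_of_notMem hS hT ha]
  · simp [coeff_wordSeries, ncard_wordsAvoiding_hasFixedLetter_of_not_le ha]

lemma wordSeries_insert_of_mem [Fintype κ] {S T : Finset κ} {i : κ} (hS : i ∈ S)
    (hT : i ∉ T) :
    wordSeries S T = wordSeries S (insert i T) + X i * wordSeries S (insert i T) := by
  ext a
  rw [map_add, X, coeff_monomial_mul, coeff_wordSeries, ncard_wordsAvoiding_eq_add (i := i)]
  split_ifs with ha
  · simp [coeff_wordSeries, ncard_wordsAvoiding_of_mem hS hT ha]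
  · simp [coeff_wordSeries, ncard_wordsAvoiding_hasFixedLetter_of_not_le ha]

/-- The coefficient of `X ^ m` in `(1 + X)⁻¹` for a descending letter of `T`, in `1 - X` for an
ascending letter of `T`, and in `1` for a letter outside `T`. -/
def letterCoeff (S T : Finset κ) (i : κ) (m : ℕ) : ℚ :=
  if i ∈ T then if i ∈ S ∨ m ≤ 1 then (-1) ^ m else 0 else if m = 0 then 1 else 0

/-- The product of the series with coefficients `letterCoeff S T i` in the variables `X i`. -/
def letterSeries [Fintype κ] (S T : Finset κ) : MvPowerSeries κ ℚ :=
  fun b => ∏ i, letterCoeff S T i (b i)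

lemma coeff_letterSeries [Fintype κ] (S T : Finset κ) (b : κ →₀ ℕ) :
    coeff b (letterSeries S T) = ∏ i, letterCoeff S T i (b i) := rfl

lemma letterCoeff_insert_of_ne (S T : Finset κ) {i j : κ} (h : j ≠ i) (m : ℕ) :
    letterCoeff S (insert i T) j m = letterCoeff S T j m := by
  simp [letterCoeff, h]

lemma coeff_X_mul_letterSeries [Fintype κ] (S T : Finset κ) (i : κ) (b : κ →₀ ℕ) :
    coeff b (X i * letterSeries S T) =
      (if b i = 0 then 0 else letterCoeff S T i (b i - 1)) *
        ∏ j ∈ Finset.univ.erase i, letterCoeff S T j (b j) := by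
  rw [X, coeff_monomial_mul]
  by_cases hb : b i = 0
  · simp [hb]
  · rw [if_pos (by rw [Finsupp.single_le_iff]; omega), if_neg hb, one_mul, coeff_letterSeries,
      ← Finset.mul_prod_erase _ _ (Finset.mem_univ i)]
    congr 1
    · simp
    · refine Finset.prod_congr rfl fun j hj => ?_
      simp [(Finset.ne_of_mem_erase hj).symm]

lemma coeff_letterSeries_insert [Fintype κ] (S T : Finset κ) (i : κ) (b : κ →₀ ℕ) :
    coeff b (letterSeries S (insert i T)) = letterCoeff S (insert i T) i (b i) *
      ∏ j ∈ Finset.univ.erase i, letterCoeff S T j (b j) := by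
  rw [coeff_letterSeries, ← Finset.mul_prod_erase _ _ (Finset.mem_univ i)]
  congr 1
  exact Finset.prod_congr rfl fun j hj =>
    letterCoeff_insert_of_ne S T (Finset.ne_of_mem_erase hj) _

lemma letterSeries_insert_of_notMem [Fintype κ] {S T : Finset κ} {i : κ} (hS : i ∉ S)
    (hT : i ∉ T) : letterSeries S T = letterSeries S (insert i T) + X i * letterSeries S T := by
  ext b
  rw [map_add, coeff_X_mul_letterSeries, coeff_letterSeries_insert, coeff_letterSeries,
    ← Finset.mul_prod_erase _ _ (Finset.mem_univ i), ← add_mul]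
  congr 1
  rcases hb : b i with _ | _ | m <;> simp [letterCoeff, hS, hT]

lemma letterSeries_insert_of_mem [Fintype κ] {S T : Finset κ} {i : κ} (hS : i ∈ S)
    (hT : i ∉ T) :
    letterSeries S T = letterSeries S (insert i T) + X i * letterSeries S (insert i T) := by
  ext b
  have : ∏ j ∈ Finset.univ.erase i, letterCoeff S (insert i T) j (b j) =
      ∏ j ∈ Finset.univ.erase i, letterCoeff S T j (b j) :=
    Finset.prod_congr rfl fun j hj => letterCoeff_insert_of_ne S T (Finset.ne_of_mem_erase hj) _
  rw [map_add, coeff_X_mul_letterSeries, coeff_letterSeries_insert, coeff_letterSeries,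
    ← Finset.mul_prod_erase _ _ (Finset.mem_univ i), this, ← add_mul]
  congr 1
  rcases hb : b i with _ | m <;> simp [letterCoeff, hS, hT, pow_succ]

lemma wordSeries_eq_mul_letterSeries [Fintype κ] (S T : Finset κ) :
    wordSeries S T = wordSeries S ∅ * letterSeries S T := by
  induction T using Finset.induction_on with
  | empty =>
    have : letterSeries S (∅ : Finset κ) = 1 := by
      ext b
      rw [coeff_letterSeries, coeff_one]
      simp [letterCoeff, Finset.prod_ite_zero, Finsupp.ext_iff]
    rw [this, mul_one]
  | insert i T hT ih =>
    by_cases hS : i ∈ S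
    · have h₁ := wordSeries_insert_of_mem hS hT
      have h₂ := letterSeries_insert_of_mem hS hT
      have h₀ : (1 + X i : MvPowerSeries κ ℚ) ≠ 0 := by
        intro h
        simpa using congrArg constantCoeff h
      refine mul_left_cancel₀ h₀ ?_
      linear_combination ih - h₁ + wordSeries S ∅ * h₂
    · have h₁ := wordSeries_insert_of_notMem hS hT
      have h₂ := letterSeries_insert_of_notMem hS hT
      linear_combination (1 - X i) * ih - h₁ + wordSeries S ∅ * h₂

end Counting

section SignedSubsets

set_option linter.unusedSectionVars false

open Equiv Equiv.Perm Finset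

variable {α : Type*} [Fintype α] [DecidableEq α]

lemma Equiv.Perm.apply_mem_iff_of_mapsTo {π : Perm α} {P : Finset α} (h : ∀ x ∈ P, π x ∈ P)
    (x : α) : π x ∈ P ↔ x ∈ P := by
  refine ⟨fun hx => ?_, h x⟩
  have : P.image π = P :=
    eq_of_subset_of_card_le (image_subset_iff.2 h) (card_image_of_injective _ π.injective).ge
  rw [← this, mem_image] at hx
  obtain ⟨y, hy, hyx⟩ := hx
  rwa [← π.injective hyx]

/-- The permutation that agrees with `π` on the `π`-stable set `P` and is the identity elsewhere
(and the identity if `P` is not `π`-stable). -/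
def restrictPerm (π : Perm α) (P : Finset α) : Perm α :=
  if h : ∀ x, π x ∈ P ↔ x ∈ P then ofSubtype (π.subtypePerm h) else 1

lemma restrictPerm_apply {π : Perm α} {P : Finset α} (h : ∀ x ∈ P, π x ∈ P) (x : α) :
    restrictPerm π P x = if x ∈ P then π x else x := by
  rw [restrictPerm, dif_pos (apply_mem_iff_of_mapsTo h)]
  split_ifs with hx
  · rw [ofSubtype_apply_of_mem _ hx, subtypePerm_apply]
  · exact ofSubtype_apply_of_not_mem _ hx

lemma restrictPerm_union {π : Perm α} {P Q : Finset α} (hP : ∀ x ∈ P, π x ∈ P)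
    (hQ : ∀ x ∈ Q, π x ∈ Q) (hPQ : Disjoint P Q) :
    restrictPerm π (P ∪ Q) = restrictPerm π P * restrictPerm π Q := by
  ext x
  have hPQ' : ∀ x ∈ P ∪ Q, π x ∈ P ∪ Q := fun x hx =>
    mem_union.2 ((mem_union.1 hx).imp (hP x) (hQ x))
  rw [Perm.mul_apply, restrictPerm_apply hP, restrictPerm_apply hQ, restrictPerm_apply hPQ']
  rw [disjoint_left] at hPQ
  by_cases h₁ : x ∈ P
  · simp [h₁, hPQ h₁]
  · by_cases h₂ : x ∈ Q
    · have : π x ∉ P := fun h => hPQ h (hQ x h₂)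
      simp [h₁, h₂, this]
    · simp [h₁, h₂]

lemma restrictPerm_swap_mul {π : Perm α} {P : Finset α} (h : ∀ x ∈ P, π x ∈ P) {x y : α}
    (hx : x ∈ P) (hy : y ∈ P) : restrictPerm (swap x y * π) P = swap x y * restrictPerm π P := by
  have h' : ∀ z ∈ P, (swap x y * π) z ∈ P := fun z hz => by
    have := h z hz
    rw [Perm.mul_apply, swap_apply_def]
    split_ifs <;> assumption
  ext z
  rw [Perm.mul_apply, restrictPerm_apply h', restrictPerm_apply h]
  split_ifs with hz
  · rfl
  · rw [swap_apply_of_ne_of_ne] <;> rintro rfl <;> contradiction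

lemma restrictPerm_support_of_mem_cycleFactorsFinset {π σ : Perm α}
    (hσ : σ ∈ π.cycleFactorsFinset) : restrictPerm π σ.support = σ := by
  have h := (mem_cycleFactorsFinset_iff.1 hσ).2
  ext x
  rw [restrictPerm_apply fun x hx => by rw [← h x hx]; exact apply_mem_support.2 hx]
  split_ifs with hx
  · rw [h x hx]
  · rw [notMem_support.1 hx]

variable {κ : Type*} [DecidableEq κ]

/-- `B` is stable under `π`, and `π` preserves the colours of its elements. -/
def IsColorStable (c : α → κ) (π : Perm α) (B : Finset α) : Prop :=
  ∀ x ∈ B, π x ∈ B ∧ c (π x) = c x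

instance (c : α → κ) (π : Perm α) (B : Finset α) : Decidable (IsColorStable c π B) :=
  inferInstanceAs (Decidable (∀ x ∈ B, π x ∈ B ∧ c (π x) = c x))

lemma IsColorStable.mapsTo_filter {c : α → κ} {π : Perm α} {B : Finset α}
    (h : IsColorStable c π B) (p : κ → Prop) [DecidablePred p] :
    ∀ x ∈ B.filter (fun x => p (c x)), π x ∈ B.filter (fun x => p (c x)) := by
  intro x hx
  rw [mem_filter] at hx ⊢
  exact ⟨(h x hx.1).1, (h x hx.1).2 ▸ hx.2⟩

lemma IsColorStable.union {c : α → κ} {π : Perm α} {B C : Finset α} (hB : IsColorStable c π B)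
    (hC : IsColorStable c π C) : IsColorStable c π (B ∪ C) := by
  intro x hx
  rcases mem_union.1 hx with hx | hx
  · exact ⟨mem_union_left _ (hB x hx).1, (hB x hx).2⟩
  · exact ⟨mem_union_right _ (hC x hx).1, (hC x hx).2⟩

lemma IsColorStable.of_sameCycle {c : α → κ} {π : Perm α} {B : Finset α}
    (hB : IsColorStable c π B) {x y : α} (hx : x ∈ B) (h : π.SameCycle x y) :
    y ∈ B ∧ c y = c x := by
  obtain ⟨m, -, rfl⟩ := h.exists_pow_eq'
  clear h
  induction m with
  | zero => simp [hx]
  | succ m ih =>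
    rw [pow_succ', Perm.mul_apply]
    exact ⟨(hB _ ih.1).1, (hB _ ih.1).2.trans ih.2⟩

/-- The product over the cycles of `π` inside the colour-stable set `B` of `(-1) ^ length` for
cycles of colour in `S` and of `-1` for the other ones. -/
def stableWeight (S : Finset κ) (c : α → κ) (π : Perm α) (B : Finset α) : ℤ :=
  (-1) ^ #B * (sign (restrictPerm π (B.filter (fun x => c x ∉ S))) : ℤ)

lemma stableWeight_union (S : Finset κ) {c : α → κ} {π : Perm α} {B C : Finset α}
    (hB : IsColorStable c π B) (hC : IsColorStable c π C) (h : Disjoint B C) :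
    stableWeight S c π (B ∪ C) = stableWeight S c π B * stableWeight S c π C := by
  rw [stableWeight, filter_union, restrictPerm_union
    (hB.mapsTo_filter (· ∉ S)) (hC.mapsTo_filter (· ∉ S))
    (disjoint_filter_filter h), card_union_of_disjoint h, pow_add, Perm.sign_mul, Units.val_mul]
  unfold stableWeight
  ring

lemma restrictPerm_eq_one {π : Perm α} {P : Finset α} (h : ∀ x ∈ P, π x = x) :
    restrictPerm π P = 1 := by
  ext x
  rw [restrictPerm_apply fun x hx => by rwa [h x hx]]
  split_ifs with hx
  · rw [h x hx, Perm.one_apply]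
  · rfl

lemma stableWeight_singleton (S : Finset κ) (c : α → κ) {π : Perm α} {x : α} (hx : π x = x) :
    stableWeight S c π {x} = -1 := by
  rw [stableWeight, restrictPerm_eq_one]
  · simp
  · intro y hy
    rw [mem_filter, mem_singleton] at hy
    rw [hy.1, hx]

lemma isColorStable_singleton (c : α → κ) {π : Perm α} {x : α} (hx : π x = x) :
    IsColorStable c π {x} := by
  intro y hy
  rw [mem_singleton] at hy
  simp [hy, hx]

lemma isColorStable_erase {c : α → κ} {π : Perm α} {x : α} (hx : π x = x) {B : Finset α}
    (hB : IsColorStable c π B) : IsColorStable c π (B.erase x) := by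
  intro y hy
  rw [mem_erase] at hy ⊢
  refine ⟨⟨fun h => hy.1 (π.injective (h.trans hx.symm)), (hB y hy.2).1⟩, (hB y hy.2).2⟩

lemma isColorStable_insert {c : α → κ} {π : Perm α} {x : α} (hx : π x = x) {B : Finset α}
    (hB : IsColorStable c π B) : IsColorStable c π (insert x B) := by
  rw [insert_eq]
  exact (isColorStable_singleton c hx).union hB

lemma stableWeight_insert (S : Finset κ) {c : α → κ} {π : Perm α} {x : α} (hx : π x = x)
    {B : Finset α} (hB : IsColorStable c π B) (hxB : x ∉ B) :
    stableWeight S c π (insert x B) = -stableWeight S c π B := by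
  rw [insert_eq, stableWeight_union S (isColorStable_singleton c hx) hB (by simpa using hxB),
    stableWeight_singleton S c hx, neg_one_mul]

lemma sum_stableWeight_eq_zero (S : Finset κ) (c : α → κ) {π : Perm α} {x : α} (hx : π x = x) :
    ∑ B : Finset α with IsColorStable c π B, stableWeight S c π B = 0 := by
  refine sum_involution (fun B _ => if x ∈ B then B.erase x else insert x B) ?_ ?_ ?_ ?_
  · intro B hB
    have hB := (mem_filter.1 hB).2
    split_ifs with h
    · conv_lhs => rw [← insert_erase h, erase_insert (notMem_erase x B)]
      rw [stableWeight_insert S hx (isColorStable_erase hx hB) (notMem_erase x B),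
        neg_add_cancel]
    · rw [stableWeight_insert S hx hB h, add_neg_cancel]
  · intro B _ _ h
    split_ifs at h with hxB
    · exact erase_ne_self.2 hxB h
    · exact insert_ne_self.2 hxB h
  · intro B hB
    have hB := (mem_filter.1 hB).2
    rw [mem_filter]
    split_ifs
    · exact ⟨mem_univ _, isColorStable_erase hx hB⟩
    · exact ⟨mem_univ _, isColorStable_insert hx hB⟩
  · intro B _
    by_cases h : x ∈ B
    · simp [h]
    · simp [h]

/-- The nontrivial cycles of `π` all of whose elements have the same colour. -/
def monochromaticCycles [Fintype κ] (c : α → κ) (π : Perm α) : Finset (Perm α) :=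
  π.cycleFactorsFinset.filter (fun σ => ∃ i, ∀ x ∈ σ.support, c x = i)

section Monochromatic

variable [Fintype κ] {c : α → κ} {π σ : Perm α}

lemma isColorStable_support (hσ : σ ∈ monochromaticCycles c π) :
    IsColorStable c π σ.support := by
  obtain ⟨hσ, i, hi⟩ := mem_filter.1 hσ
  intro x hx
  rw [← (mem_cycleFactorsFinset_iff.1 hσ).2 x hx]
  have := apply_mem_support.2 hx
  exact ⟨this, (hi _ this).trans (hi x hx).symm⟩

lemma eq_of_mem_support (hσ : σ ∈ monochromaticCycles c π) {τ : Perm α}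
    (hτ : τ ∈ monochromaticCycles c π) {x : α} (hxσ : x ∈ σ.support) (hxτ : x ∈ τ.support) :
    σ = τ := by
  rw [cycle_is_cycleOf hxσ (mem_filter.1 hσ).1, cycle_is_cycleOf hxτ (mem_filter.1 hτ).1]

lemma isColorStable_biUnion_support {T : Finset (Perm α)}
    (hT : T ⊆ monochromaticCycles c π) : IsColorStable c π (T.biUnion support) := by
  intro x hx
  obtain ⟨σ, hσ, hxσ⟩ := mem_biUnion.1 hx
  have := isColorStable_support (hT hσ) x hxσ
  exact ⟨mem_biUnion.2 ⟨σ, hσ, this.1⟩, this.2⟩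

lemma stableWeight_biUnion_support (S : Finset κ) {T : Finset (Perm α)}
    (hT : T ⊆ monochromaticCycles c π) :
    stableWeight S c π (T.biUnion support) = ∏ σ ∈ T, stableWeight S c π σ.support := by
  induction T using Finset.induction_on with
  | empty => simp [stableWeight, restrictPerm_eq_one]
  | insert σ T hσ ih =>
    rw [insert_subset_iff] at hT
    rw [biUnion_insert, prod_insert hσ, ← ih hT.2]
    refine stableWeight_union S (isColorStable_support hT.1) (isColorStable_biUnion_support hT.2) ?_
    rw [disjoint_biUnion_right]
    intro τ hτ
    rw [disjoint_left]
    intro x hxσ hxτ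
    exact hσ (eq_of_mem_support hT.1 (hT.2 hτ) hxσ hxτ ▸ hτ)

lemma sum_stableWeight_eq_prod (S : Finset κ) (hπ : ∀ x, π x ≠ x) :
    ∑ B : Finset α with IsColorStable c π B, stableWeight S c π B =
      ∏ σ ∈ monochromaticCycles c π, (1 + stableWeight S c π σ.support) := by
  rw [prod_one_add]
  symm
  refine sum_nbij' (fun T => T.biUnion support)
    (fun B => (monochromaticCycles c π).filter (fun σ => σ.support ⊆ B)) ?_ ?_ ?_ ?_ ?_
  · intro T hT
    exact mem_filter.2 ⟨mem_univ _, isColorStable_biUnion_support (mem_powerset.1 hT)⟩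
  · intro B _
    exact mem_powerset.2 (filter_subset _ _)
  · intro T hT
    rw [mem_powerset] at hT
    ext σ
    rw [mem_filter]
    refine ⟨fun ⟨hσ, h⟩ => ?_, fun hσ => ⟨hT hσ, subset_biUnion_of_mem support hσ⟩⟩
    obtain ⟨x, hx⟩ := (mem_cycleFactorsFinset_iff.1 (mem_filter.1 hσ).1).1.nonempty_support
    obtain ⟨τ, hτ, hxτ⟩ := mem_biUnion.1 (h hx)
    rwa [eq_of_mem_support hσ (hT hτ) hx hxτ]
  · intro B hB
    have hB := (mem_filter.1 hB).2
    ext x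
    rw [mem_biUnion]
    constructor
    · rintro ⟨σ, hσ, hx⟩
      exact (mem_filter.1 hσ).2 hx
    · intro hx
      have hxs : x ∈ π.support := mem_support.2 (hπ x)
      have h (y) (hy : y ∈ (π.cycleOf x).support) : y ∈ B ∧ c y = c x :=
        hB.of_sameCycle hx (mem_support_cycleOf_iff.1 hy).1
      refine ⟨π.cycleOf x, ?_, mem_support_cycleOf_iff.2 ⟨SameCycle.refl _ _, hxs⟩⟩
      rw [mem_filter, monochromaticCycles, mem_filter, cycleOf_mem_cycleFactorsFinset_iff]
      exact ⟨⟨hxs, c x, fun y hy => (h y hy).2⟩, fun y hy => (h y hy).1⟩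
  · intro T hT
    exact (stableWeight_biUnion_support S (mem_powerset.1 hT)).symm

lemma stableWeight_support_of_mem {S : Finset κ} {i : κ} (hi : i ∈ S)
    (h : ∀ x ∈ σ.support, c x = i) : stableWeight S c π σ.support = (-1) ^ #σ.support := by
  have : σ.support.filter (fun x => c x ∉ S) = ∅ :=
    filter_eq_empty_iff.2 fun x hx => by rw [h x hx]; exact not_not.2 hi
  rw [stableWeight, this, restrictPerm_eq_one (by simp)]
  simp

lemma stableWeight_support_of_notMem {S : Finset κ} {i : κ} (hi : i ∉ S)
    (hσ : σ ∈ π.cycleFactorsFinset) (h : ∀ x ∈ σ.support, c x = i) :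
    stableWeight S c π σ.support = -1 := by
  have : σ.support.filter (fun x => c x ∉ S) = σ.support :=
    filter_eq_self.2 fun x hx => by rwa [h x hx]
  rw [stableWeight, this, restrictPerm_support_of_mem_cycleFactorsFinset hσ,
    (mem_cycleFactorsFinset_iff.1 hσ).1.sign]
  simp [← mul_pow]

/-- The weight `c_S(π)` as a signed sum over colour-stable sets. -/
lemma sum_stableWeight (S : Finset κ) (c : α → κ) (π : Perm α) :
    ∑ B : Finset α with IsColorStable c π B, stableWeight S c π B =
      if (∃ x, π x = x) ∨ ∃ σ ∈ monochromaticCycles c π,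
        Odd #σ.support ∨ ∃ i ∉ S, ∀ x ∈ σ.support, c x = i then 0
      else 2 ^ #(monochromaticCycles c π) := by
  by_cases hπ : ∃ x, π x = x
  · obtain ⟨x, hx⟩ := hπ
    rw [sum_stableWeight_eq_zero S c hx, if_pos (Or.inl ⟨x, hx⟩)]
  rw [sum_stableWeight_eq_prod S (not_exists.1 hπ)]
  split_ifs with h
  · obtain ⟨σ, hσ, h⟩ := h.resolve_left hπ
    refine prod_eq_zero hσ ?_
    obtain ⟨hσ', i, hi⟩ := mem_filter.1 hσ
    by_cases hiS : i ∈ S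
    · rcases h with h | ⟨j, hj, hjσ⟩
      · simp [stableWeight_support_of_mem hiS hi, h.neg_one_pow]
      · simp [stableWeight_support_of_notMem hj hσ' hjσ]
    · simp [stableWeight_support_of_notMem hiS hσ' hi]
  · push Not at h
    rw [prod_eq_pow_card]
    intro σ hσ
    obtain ⟨-, i, hi⟩ := mem_filter.1 hσ
    obtain ⟨hodd, hS⟩ := h.2 σ hσ
    have hiS : i ∈ S := by
      by_contra hiS
      obtain ⟨x, hx, hxi⟩ := hS i hiS
      exact hxi (hi x hx)
    rw [stableWeight_support_of_mem hiS hi, (Nat.not_odd_iff_even.1 hodd).neg_one_pow]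
    rfl

end Monochromatic

end SignedSubsets

section Profiles

set_option linter.unusedSectionVars false

open Equiv Equiv.Perm Finset

variable {α : Type*} [Fintype α] [DecidableEq α] {κ : Type*} [DecidableEq κ] [Fintype κ]

/-- The number of elements of `B` of each colour. -/
noncomputable def colorCount (c : α → κ) (B : Finset α) : κ →₀ ℕ :=
  Finsupp.equivFunOnFinite.symm fun i => #(B.filter (fun x => c x = i))

lemma colorCount_apply (c : α → κ) (B : Finset α) (i : κ) :
    colorCount c B i = #(B.filter (fun x => c x = i)) := rfl

lemma colorCount_add_compl (c : α → κ) (B : Finset α) :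
    colorCount c B + colorCount c Bᶜ = colorCount c univ := by
  ext i
  simp only [Finsupp.add_apply, colorCount_apply]
  rw [← card_union_of_disjoint (disjoint_filter_filter disjoint_compl_right), ← filter_union,
    union_compl]

lemma sum_colorCount (c : α → κ) (B : Finset α) : ∑ i, colorCount c B i = #B :=
  (card_eq_sum_card_fiberwise fun _ _ => mem_univ _).symm

lemma card_filter_colorCount_eq (c : α → κ) (b : κ →₀ ℕ) :
    #{B : Finset α | colorCount c B = b} = ∏ i, (colorCount c univ i).choose (b i) := by
  have : ∏ i, (colorCount c univ i).choose (b i) =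
      #(Fintype.piFinset fun i => powersetCard (b i) (univ.filter (fun x => c x = i))) := by
    simp [colorCount_apply]
  rw [this]
  refine card_nbij' (fun B i => B.filter (fun x => c x = i)) (fun f => univ.biUnion f) ?_ ?_ ?_ ?_
  · intro B hB
    simp only [coe_filter, mem_univ, true_and, Set.mem_ofPred_eq] at hB
    subst hB
    simp only [mem_coe, Fintype.mem_piFinset, mem_powersetCard]
    exact fun i => ⟨filter_subset_filter _ (subset_univ B), rfl⟩
  · intro f hf
    simp only [mem_coe, Fintype.mem_piFinset, mem_powersetCard] at hf
    simp only [coe_filter, mem_univ, true_and, Set.mem_ofPred_eq]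
    ext i
    rw [colorCount_apply, ← (hf i).2]
    congr 1
    ext x
    simp only [mem_filter, mem_biUnion, mem_univ, true_and]
    constructor
    · rintro ⟨⟨j, hj⟩, rfl⟩
      have := (hf j).1 hj
      rw [mem_filter] at this
      rwa [this.2]
    · intro hx
      have := (hf i).1 hx
      rw [mem_filter] at this
      exact ⟨⟨i, hx⟩, this.2⟩
  · intro B _
    ext x
    simp
  · intro f hf
    simp only [mem_coe, Fintype.mem_piFinset, mem_powersetCard] at hf
    ext i x
    simp only [mem_filter, mem_biUnion, mem_univ, true_and]
    constructor
    · rintro ⟨⟨j, hj⟩, rfl⟩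
      have := (hf j).1 hj
      rw [mem_filter] at this
      rwa [this.2]
    · intro hx
      have := (hf i).1 hx
      rw [mem_filter] at this
      exact ⟨⟨i, hx⟩, this.2⟩

lemma card_isColorStable (c : α → κ) (B : Finset α) :
    #{π : Perm α | IsColorStable c π B} =
      (∏ i, (colorCount c B i).factorial) * (#Bᶜ).factorial := by
  let c' : α → Option κ := fun x => if x ∈ B then some (c x) else none
  have h (π : Perm α) : IsColorStable c π B ↔ c' ∘ π = c' := by
    constructor
    · intro h
      have hB := apply_mem_iff_of_mapsTo (fun x hx => (h x hx).1)
      ext1 x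
      by_cases hx : x ∈ B
      · simp [c', hB, hx, (h x hx).2]
      · simp [c', hB, hx]
    · intro h x hx
      have := congrFun h x
      simp only [c', Function.comp_apply, hx, if_true] at this
      split_ifs at this with hπx
      · exact ⟨hπx, Option.some_injective _ this⟩
  rw [filter_congr fun π _ => h π, ← Fintype.card_subtype, DomMulAct.stabilizer_card c',
    Fintype.prod_option, mul_comm]
  congr 1
  · refine prod_congr rfl fun i _ => ?_
    rw [Fintype.card_subtype, colorCount_apply]
    congr 2
    ext x
    simp [c']
  · rw [Fintype.card_subtype]
    congr 2
    ext x
    simp [c']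

end Profiles

section Evaluation

open Equiv Equiv.Perm Finset

variable {α : Type*} [Fintype α] [DecidableEq α] {κ : Type*} [LinearOrder κ] [Fintype κ]

lemma sum_perm_stableWeight (S : Finset κ) (c : α → κ) (B : Finset α) :
    ((∑ π : Perm α with IsColorStable c π B, stableWeight S c π B : ℤ) : ℚ) =
      (∏ i, letterCoeff S univ i (colorCount c B i)) *
        ((∏ i, (colorCount c B i).factorial) * (#Bᶜ).factorial) := by
  by_cases h : ∃ i ∉ S, 1 < colorCount c B i
  · obtain ⟨i, hi, hB⟩ := h
    rw [prod_eq_zero (mem_univ i) (by simp [letterCoeff, hi, hB]), zero_mul, Int.cast_eq_zero]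
    obtain ⟨x, hx, y, hy, hxy⟩ := one_lt_card.1 hB
    rw [mem_filter] at hx hy
    have hst (π : Perm α) (hπ : IsColorStable c π B) : IsColorStable c (swap x y * π) B := by
      intro z hz
      obtain ⟨h₁, h₂⟩ := hπ z hz
      rw [Perm.mul_apply, swap_apply_def]
      split_ifs with h₃ h₄
      · exact ⟨hy.1, by rw [← h₂, h₃, hx.2, hy.2]⟩
      · exact ⟨hx.1, by rw [← h₂, h₄, hx.2, hy.2]⟩
      · exact ⟨h₁, h₂⟩
    refine sum_involution (fun π _ => swap x y * π) ?_ ?_ ?_ ?_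
    · intro π hπ
      have hπ := (mem_filter.1 hπ).2
      rw [stableWeight, stableWeight, restrictPerm_swap_mul (hπ.mapsTo_filter (· ∉ S))
        (mem_filter.2 ⟨hx.1, by rwa [hx.2]⟩) (mem_filter.2 ⟨hy.1, by rwa [hy.2]⟩), Perm.sign_mul,
        sign_swap hxy]
      simp
    · intro π _ _ h
      rw [mul_eq_right, swap_eq_one_iff] at h
      exact hxy h
    · intro π hπ
      exact mem_filter.2 ⟨mem_univ _, hst π (mem_filter.1 hπ).2⟩
    · intro π _
      exact swap_mul_self_mul x y π
  · push Not at h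
    have hw (π) (hπ : π ∈ univ.filter (fun π : Perm α => IsColorStable c π B)) :
        stableWeight S c π B = (-1) ^ #B := by
      have hπ := (mem_filter.1 hπ).2
      rw [stableWeight, restrictPerm_eq_one, Perm.sign_one, Units.val_one, mul_one]
      intro x hx
      rw [mem_filter] at hx
      exact card_le_one.1 (h _ hx.2) _ (mem_filter.2 (hπ x hx.1)) _ (mem_filter.2 ⟨hx.1, rfl⟩)
    have hc : ∏ i, letterCoeff S univ i (colorCount c B i) = (-1) ^ #B := by
      rw [← sum_colorCount c B, ← prod_pow_eq_pow_sum]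
      refine prod_congr rfl fun i _ => ?_
      rw [letterCoeff, if_pos (mem_univ i), if_pos]
      by_contra hi
      push Not at hi
      exact absurd (h i hi.1) (by omega)
    rw [sum_congr rfl hw, sum_const, card_isColorStable, hc]
    push_cast
    simp
    ring

lemma sum_perm_sum_stableWeight (S : Finset κ) (c : α → κ) :
    (∏ i, ((colorCount c univ i).factorial : ℚ))⁻¹ *
      ((∑ π : Perm α, ∑ B : Finset α with IsColorStable c π B, stableWeight S c π B : ℤ) : ℚ) =
    (wordsAvoiding S univ (colorCount c univ)).ncard := by
  have hswap : ∑ π : Perm α, ∑ B : Finset α with IsColorStable c π B, stableWeight S c π B =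
      ∑ B : Finset α, ∑ π : Perm α with IsColorStable c π B, stableWeight S c π B := by
    simp_rw [sum_filter]
    exact sum_comm
  rw [hswap, ← coeff_wordSeries, wordSeries_eq_mul_letterSeries, MvPowerSeries.coeff_mul,
    Int.cast_sum, inv_mul_eq_iff_eq_mul₀ (prod_ne_zero_iff.2 fun i _ => by positivity)]
  simp_rw [sum_perm_stableWeight]
  rw [← sum_fiberwise_of_maps_to (t := antidiagonal (colorCount c univ))
    (g := fun B => (colorCount c Bᶜ, colorCount c B))
    (fun B _ => by rw [HasAntidiagonal.mem_antidiagonal, add_comm, colorCount_add_compl]), mul_sum]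
  refine sum_congr rfl fun p hp => ?_
  rw [HasAntidiagonal.mem_antidiagonal] at hp
  have hfilter : univ.filter (fun B : Finset α => (colorCount c Bᶜ, colorCount c B) = p) =
      univ.filter (fun B => colorCount c B = p.2) := by
    refine filter_congr fun B _ => ⟨fun h => h ▸ rfl, fun h => Prod.ext ?_ h⟩
    have := colorCount_add_compl c B
    rw [h, ← hp, add_comm] at this
    exact add_right_cancel this
  have hterm (B) (hB : B ∈ univ.filter (fun B => (colorCount c Bᶜ, colorCount c B) = p)) :
      (∏ i, letterCoeff S univ i (colorCount c B i)) *
        ((∏ i, ((colorCount c B i).factorial : ℚ)) * (#Bᶜ).factorial) =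
      (∏ i, letterCoeff S univ i (p.2 i)) *
        ((∏ i, ((p.2 i).factorial : ℚ)) * (∑ i, p.1 i).factorial) := by
    rw [mem_filter] at hB
    rw [← hB.2, sum_colorCount]
  rw [sum_congr rfl (by exact_mod_cast hterm), sum_const, hfilter, card_filter_colorCount_eq,
    coeff_wordSeries, coeff_letterSeries, ← ncard_wordsAvoiding_empty S p.1]
  have hfact : ∏ i, (colorCount c univ i).factorial =
      (∏ i, (colorCount c univ i).choose (p.2 i)) *
        ((∏ i, (p.2 i).factorial) * ∏ i, (p.1 i).factorial) := by
    rw [← prod_mul_distrib, ← prod_mul_distrib]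
    refine prod_congr rfl fun i _ => ?_
    rw [← hp, Finsupp.add_apply, ← mul_assoc, mul_right_comm,
      ← Nat.add_choose_mul_factorial_mul_factorial]
  rw [← Nat.cast_prod, hfact]
  push_cast
  rw [nsmul_eq_mul]
  push_cast
  ring

end Evaluation

section Encoding

open Finset

lemma card_filter_eq_add {α : Type*} [Fintype α] {p q r : α → Prop} [DecidablePred p]
    [DecidablePred q] [DecidablePred r] (h : ∀ x, p x ↔ q x ∨ r x) (hqr : ∀ x, q x → ¬ r x) :
    #{x | p x} = #{x | q x} + #{x | r x} := by
  classical
  rw [← card_union_of_disjoint (disjoint_filter.2 fun x _ => hqr x), ← filter_or,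
    filter_congr fun x _ => h x]

lemma countP_take_ofFn {β : Type*} (p : β → Prop) [DecidablePred p] {n : ℕ} (f : Fin n → β)
    (m : ℕ) : ((List.ofFn f).take m).countP (p ·) = #{x | x.1 < m ∧ p (f x)} := by
  induction n generalizing m with
  | zero => simp
  | succ n ih =>
    cases m with
    | zero => simp
    | succ m =>
      rw [List.ofFn_succ, List.take_succ_cons, List.countP_cons, ih, Fin.card_filter_univ_succ]
      simp only [Fin.val_zero, Nat.zero_lt_succ, true_and, Fin.val_succ,
        Nat.add_lt_add_iff_right, decide_eq_true_eq]
      split_ifs <;> rfl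

lemma countP_ofFn {β : Type*} (p : β → Prop) [DecidablePred p] {n : ℕ} (f : Fin n → β) :
    (List.ofFn f).countP (p ·) = #{x | p (f x)} := by
  simpa [List.take_of_length_le] using countP_take_ofFn p f n

lemma countP_drop_ofFn {β : Type*} (p : β → Prop) [DecidablePred p] {n : ℕ} (f : Fin n → β)
    (m : ℕ) : ((List.ofFn f).drop m).countP (p ·) = #{x | m ≤ x.1 ∧ p (f x)} := by
  have h := countP_ofFn p f
  have h' : #{x | p (f x)} = #{x | x.1 < m ∧ p (f x)} + #{x | m ≤ x.1 ∧ p (f x)} := by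
    refine card_filter_eq_add (fun x => ?_) fun x => ?_
    · have := lt_or_ge x.1 m
      tauto
    · omega
  rw [← List.take_append_drop m (List.ofFn f), List.countP_append, countP_take_ofFn] at h
  omega

lemma count_ofFn {β : Type*} [DecidableEq β] {n : ℕ} (f : Fin n → β) (i : β) :
    (List.ofFn f).count i = #{x | f x = i} := by
  rw [← countP_ofFn (· = i), List.count]
  congr 1

variable {κ : Type*} [LinearOrder κ] {n : ℕ}

/-- The permutation `π` decreases on the colour classes of `c` with colour in `S` and increases on
the others. -/
def IsClassMonotone (S : Finset κ) (c : Fin n → κ) (π : Equiv.Perm (Fin n)) : Prop :=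
  ∀ ⦃x y⦄, x < y → c x = c y → if c x ∈ S then π y < π x else π x < π y

/-- The sorting key of a position in a word. -/
def sortKey (S : Finset κ) (w : Fin n → κ) (p : Fin n) : κ ×ₗ ℤ :=
  toLex (w p, if w p ∈ S then -(p : ℤ) else p)

lemma sortKey_injective (S : Finset κ) (w : Fin n → κ) : Function.Injective (sortKey S w) := by
  intro p q h
  have h := toLex.injective h
  rw [Prod.mk.injEq] at h
  obtain ⟨h₁, h₂⟩ := h
  rw [h₁] at h₂
  ext
  split_ifs at h₂ <;> omega

lemma isClassMonotone_iff {S : Finset κ} {c : Fin n → κ} (hc : Monotone c)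
    {π : Equiv.Perm (Fin n)} :
    IsClassMonotone S c π ↔ Monotone (sortKey S (c ∘ π.symm) ∘ π) := by
  have hinj := (sortKey_injective S (c ∘ π.symm)).comp π.injective
  constructor
  · intro h
    refine StrictMono.monotone fun x y hxy => ?_
    simp only [sortKey, Function.comp_apply, Equiv.symm_apply_apply, Prod.Lex.toLex_lt_toLex]
    rcases (hc hxy.le).lt_or_eq with hlt | heq
    · exact Or.inl hlt
    · refine Or.inr ⟨heq, ?_⟩
      have := h hxy heq
      rw [← heq]
      split_ifs at this ⊢ <;> rw [Fin.lt_def] at this <;> omega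
  · intro h x y hxy heq
    have := h.strictMono_of_injective hinj hxy
    simp only [sortKey, Function.comp_apply, Equiv.symm_apply_apply, Prod.Lex.toLex_lt_toLex,
      heq, lt_irrefl, false_or, true_and] at this
    rw [heq]
    split_ifs at this ⊢ <;> rw [Fin.lt_def] <;> omega

lemma IsClassMonotone.eq_of_word_eq {S : Finset κ} {c : Fin n → κ} (hc : Monotone c)
    {π ρ : Equiv.Perm (Fin n)} (hπ : IsClassMonotone S c π) (hρ : IsClassMonotone S c ρ)
    (h : c ∘ π.symm = c ∘ ρ.symm) : π = ρ := by
  rw [isClassMonotone_iff hc] at hπ hρ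
  rw [← h] at hρ
  ext1 x
  exact sortKey_injective S _ (congrFun (Tuple.unique_monotone hπ hρ) x)

lemma exists_isClassMonotone (S : Finset κ) {c w : Fin n → κ} (hc : Monotone c)
    (hw : ∀ i, (List.ofFn w).count i = (List.ofFn c).count i) :
    ∃ π, IsClassMonotone S c π ∧ c ∘ π.symm = w := by
  set π := Tuple.sort (sortKey S w)
  have hmono : Monotone (sortKey S w ∘ π) := Tuple.monotone_sort _
  have hwmono : Monotone (w ∘ π) := Prod.Lex.monotone_fst_ofLex.comp hmono
  have heq : w ∘ π = c := by
    refine List.ofFn_injective (List.Perm.eq_of_sortedLE hwmono.sortedLE_ofFn hc.sortedLE_ofFn ?_)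
    exact (π.ofFn_comp_perm w).trans (List.perm_iff_count.2 hw)
  have heq' : c ∘ π.symm = w := by
    rw [← heq, Function.comp_assoc, Equiv.self_comp_symm, Function.comp_id]
  exact ⟨π, (isClassMonotone_iff hc).2 (by rwa [heq']), heq'⟩

lemma val_eq_card_filter {c : Fin n → κ} (hc : Monotone c) (x : Fin n) :
    x.1 = #{y | c y < c x} + #{y | y < x ∧ c y = c x} := by
  have hx : x.1 = #{y | y < x} := by rw [filter_gt_eq_Iio, Fin.card_Iio]
  refine hx.trans (card_filter_eq_add ?_ ?_)
  · refine fun y => ⟨fun h => ?_, ?_⟩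
    · rcases (hc h.le).lt_or_eq with h' | h'
      · exact Or.inl h'
      · exact Or.inr ⟨h, h'⟩
    · rintro (h | h)
      · exact hc.reflect_lt h
      · exact h.1
  · exact fun y h h' => h.ne h'.2

lemma card_filter_symm (π : Equiv.Perm (Fin n)) (p : Fin n → Prop) [DecidablePred p] :
    #{y | p (π.symm y)} = #{x | p x} := by
  refine card_nbij' π.symm π ?_ ?_ ?_ ?_ <;> intro y <;> simp

lemma IsClassMonotone.apply_eq_iff {S : Finset κ} {c : Fin n → κ} (hc : Monotone c)
    {π : Equiv.Perm (Fin n)} (hπ : IsClassMonotone S c π) (x : Fin n) :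
    π x = x ↔ BalancedCut S (c x) ((List.ofFn (c ∘ π.symm)).take (π x))
      ((List.ofFn (c ∘ π.symm)).drop (π x + 1)) := by
  have hx := val_eq_card_filter hc x
  have hlt (y : Fin n) (h : c y = c x) :
      y < x ↔ if c x ∈ S then π x < π y else π y < π x := by
    rcases lt_trichotomy y x with h' | rfl | h'
    · have := hπ h' h
      rw [h] at this
      simp only [h', true_iff]
      exact this
    · simp
    · have := hπ h' h.symm
      simp only [h'.not_gt, false_iff]
      split_ifs at this ⊢ <;> exact this.not_gt
  set w := c ∘ π.symm
  have hwx : w (π x) = c x := by simp [w]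
  have hless : #{y | c y < c x} =
      #{v | v.1 < (π x).1 ∧ w v < c x} + #{v | (π x).1 + 1 ≤ v.1 ∧ w v < c x} := by
    rw [← card_filter_symm π]
    refine card_filter_eq_add (fun v => ?_) fun v => ?_
    · change w v < c x ↔ _
      rcases lt_trichotomy v (π x) with h | rfl | h
      · simp [h, h.le]
      · simp [hwx]
      · simp [h, h.le]
    · omega
  have hequal : #{y | y < x ∧ c y = c x} =
      #{v | (if c x ∈ S then π x < v else v < π x) ∧ w v = c x} := by
    rw [← card_filter_symm π]
    refine congrArg card (filter_congr fun v _ => ?_)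
    change _ ∧ w v = c x ↔ _
    refine and_congr_left fun h => ?_
    rw [hlt _ h, Equiv.apply_symm_apply]
  have hπx : (π x).1 = #{v | v.1 < (π x).1 ∧ w v < c x} + #{v | v.1 < (π x).1 ∧ c x ≤ w v} := by
    have : (π x).1 = #{v | v < π x} := by rw [filter_gt_eq_Iio, Fin.card_Iio]
    refine this.trans (card_filter_eq_add ?_ ?_)
    · intro v
      have := lt_or_ge (w v) (c x)
      rw [Fin.lt_def]
      tauto
    · exact fun v h h' => h.2.not_ge h'.2
  rw [Fin.ext_iff, BalancedCut]
  split_ifs at hequal ⊢ with hS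
  · have hle : #{v | (π x).1 + 1 ≤ v.1 ∧ w v ≤ c x} =
        #{v | (π x).1 + 1 ≤ v.1 ∧ w v < c x} + #{v | π x < v ∧ w v = c x} := by
      refine card_filter_eq_add (fun v => ?_) fun v h h' => h.2.ne h'.2
      rw [le_iff_lt_or_eq (a := w v), and_or_left, Fin.lt_def, Nat.succ_le_iff]
    rw [countP_take_ofFn (c x ≤ ·), countP_drop_ofFn (· ≤ c x)]
    omega
  · have hge : #{v | v.1 < (π x).1 ∧ c x ≤ w v} =
        #{v | v.1 < (π x).1 ∧ c x < w v} + #{v | v < π x ∧ w v = c x} := by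
      refine card_filter_eq_add (fun v => ?_) fun v h h' => h.2.ne' h'.2
      rw [le_iff_lt_or_eq (b := w v), and_or_left, Fin.lt_def, eq_comm (a := w v)]
    rw [countP_take_ofFn (c x < ·), countP_drop_ofFn (· < c x)]
    omega

lemma IsClassMonotone.exists_apply_eq_iff {S : Finset κ} {c : Fin n → κ} (hc : Monotone c)
    {π : Equiv.Perm (Fin n)} (hπ : IsClassMonotone S c π) :
    (∃ x, π x = x) ↔ ∃ i, HasFixedLetter S i (List.ofFn (c ∘ π.symm)) := by
  constructor
  · rintro ⟨x, hx⟩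
    refine ⟨c x, _, _, ?_, (hπ.apply_eq_iff hc x).1 hx⟩
    have : (List.ofFn (c ∘ π.symm))[(π x).1]'(by simp) = c x := by simp
    rw [← this, List.getElem_cons_drop, List.take_append_drop]
  · rintro ⟨i, u, v, huv, h⟩
    have hu : u.length < n := by
      have := congrArg List.length huv
      simp at this
      omega
    have hi : c (π.symm ⟨u.length, hu⟩) = i := by
      have : (List.ofFn (c ∘ π.symm))[u.length]'(by simpa) = i := by simp [huv]
      simpa using this
    refine ⟨π.symm ⟨u.length, hu⟩, (hπ.apply_eq_iff hc _).2 ?_⟩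
    rw [hi, huv, Equiv.apply_symm_apply]
    simpa using h

variable [Fintype κ]

lemma ncard_isClassMonotone (S : Finset κ) {c : Fin n → κ} (hc : Monotone c) :
    {π | IsClassMonotone S c π ∧ ∀ x, π x ≠ x}.ncard =
      (wordsAvoiding S univ (colorCount c univ)).ncard := by
  refine Set.ncard_congr (fun π _ => List.ofFn (c ∘ π.symm)) ?_ ?_ ?_
  · rintro π ⟨hπ, hfix⟩
    refine ⟨fun i => ?_, fun i _ h => ?_⟩
    · rw [count_ofFn, colorCount_apply]
      exact card_filter_symm π fun x => c x = i
    · obtain ⟨x, hx⟩ := (hπ.exists_apply_eq_iff hc).2 ⟨i, h⟩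
      exact hfix x hx
  · rintro π ρ ⟨hπ, -⟩ ⟨hρ, -⟩ h
    exact hπ.eq_of_word_eq hc hρ (List.ofFn_injective h)
  · intro l hl
    have hlen : l.length = n := by
      rw [length_of_mem_wordsAvoiding hl, sum_colorCount, card_univ, Fintype.card_fin]
    subst hlen
    obtain ⟨π, hπ, hw⟩ := exists_isClassMonotone S (w := l.get) hc fun i => by
      rw [List.ofFn_get, hl.1, count_ofFn, colorCount_apply]
    have hl' : List.ofFn (c ∘ π.symm) = l := by rw [hw, List.ofFn_get]
    refine ⟨π, ⟨hπ, fun x hx => ?_⟩, hl'⟩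
    obtain ⟨i, hi⟩ := (hπ.exists_apply_eq_iff hc).1 ⟨x, hx⟩
    exact hl.2 i (mem_univ i) (hl' ▸ hi)

end Encoding

section Blocks

open Finset

variable {k : ℕ} (a : Fin k → ℕ)

/-- The index of the block containing `x`. -/
def blockIndex (x : Fin (∑ t, a t)) : Fin k := (finSigmaFinEquiv.symm x).1

lemma finSigmaFinEquiv_eq_blockStart_add (s : (i : Fin k) × Fin (a i)) :
    (finSigmaFinEquiv s : ℕ) = blockStart a s.1 + s.2 := by
  rw [finSigmaFinEquiv_apply, blockStart]
  congr 1
  refine sum_bij (fun i _ => Fin.castLE s.1.2.le i) (fun i _ => ?_) (fun i _ j _ h => ?_)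
    (fun j hj => ?_) fun _ _ => rfl
  · rw [mem_Iio, Fin.lt_def]
    exact i.2
  · simpa using h
  · exact ⟨⟨j, Fin.lt_def.1 (mem_Iio.1 hj)⟩, mem_univ _, rfl⟩

lemma inBlock_blockIndex (x : Fin (∑ t, a t)) : inBlock a (blockIndex a x) x := by
  obtain ⟨s, rfl⟩ := finSigmaFinEquiv.surjective x
  rw [blockIndex, Equiv.symm_apply_apply, inBlock, finSigmaFinEquiv_eq_blockStart_add]
  omega

variable {a}

lemma blockStart_add_le {i j : Fin k} (h : i < j) : blockStart a i + a i ≤ blockStart a j := by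
  rw [blockStart, blockStart, add_comm, ← sum_insert (by simp)]
  refine sum_le_sum_of_subset fun t ht => ?_
  rw [mem_insert, mem_Iio] at ht
  rw [mem_Iio]
  rcases ht with rfl | ht
  · exact h
  · exact ht.trans h

lemma inBlock.le {i j : Fin k} {x y : ℕ} (hx : inBlock a i x) (hy : inBlock a j y) (h : x ≤ y) :
    i ≤ j := by
  by_contra! hij
  have := blockStart_add_le (a := a) hij
  have := hx.1
  have := hy.2
  omega

lemma inBlock_iff {i : Fin k} {x : Fin (∑ t, a t)} : inBlock a i x ↔ blockIndex a x = i := by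
  constructor
  · intro h
    have h' := inBlock_blockIndex a x
    exact le_antisymm (h'.le h le_rfl) (h.le h' le_rfl)
  · rintro rfl
    exact inBlock_blockIndex a x

lemma monotone_blockIndex : Monotone (blockIndex a) := fun x y h =>
  (inBlock_blockIndex a x).le (inBlock_blockIndex a y) h

lemma colorCount_blockIndex (i : Fin k) : colorCount (blockIndex a) univ i = a i := by
  rw [colorCount_apply]
  conv_rhs => rw [← Fintype.card_fin (a i), ← card_univ]
  symm
  refine card_bij (fun j _ => finSigmaFinEquiv ⟨i, j⟩) (fun j _ => ?_) (fun j _ j' _ h => ?_)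
    fun x hx => ?_
  · rw [mem_filter, blockIndex, Equiv.symm_apply_apply]
    exact ⟨mem_univ _, rfl⟩
  · simpa using h
  · obtain ⟨⟨i', j⟩, rfl⟩ := finSigmaFinEquiv.surjective x
    rw [mem_filter, blockIndex, Equiv.symm_apply_apply] at hx
    obtain ⟨-, rfl⟩ := hx
    exact ⟨j, mem_univ _, rfl⟩

lemma lt_sum_of_inBlock {i : Fin k} {x : ℕ} (hx : inBlock a i x) : x < ∑ t, a t := by
  obtain ⟨hx₁, hx₂⟩ := hx
  have h := (finSigmaFinEquiv (n := a) ⟨i, ⟨x - blockStart a i, by omega⟩⟩).2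
  rw [finSigmaFinEquiv_eq_blockStart_add] at h
  simp only at h
  omega

variable {S : Finset (Fin k)} {π : Equiv.Perm (Fin (∑ t, a t))}

lemma appl_val (x : Fin (∑ t, a t)) : appl π x = π x := by
  simp [appl]

lemma IsASPerm.appl_lt_appl (h : IsASPerm a S π) {i : Fin k} {x y : ℕ} (hx : inBlock a i x)
    (hy : inBlock a i y) (hxy : x < y) :
    if i ∈ S then appl π y < appl π x else appl π x < appl π y := by
  induction y, hxy using Nat.le_induction with
  | base => exact h i x hx.1 hy.2
  | succ y hxy ih =>
    have h₁ := ih ⟨by have := hx.1; omega, by have := hy.2; omega⟩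
    have h₂ := h i y (by have := hx.1; omega) hy.2
    split_ifs at h₁ h₂ ⊢ <;> omega

lemma isASPerm_iff : IsASPerm a S π ↔ IsClassMonotone S (blockIndex a) π := by
  constructor
  · intro h x y hxy heq
    have := h.appl_lt_appl (inBlock_blockIndex a x) (inBlock_iff.2 heq.symm) hxy
    simpa only [appl_val, Fin.val_fin_lt] using this
  · intro h i j hj hj'
    have hx : inBlock a i j := ⟨hj, by omega⟩
    have hy : inBlock a i (j + 1) := ⟨by omega, hj'⟩
    have hx' := lt_sum_of_inBlock hx
    have hy' := lt_sum_of_inBlock hy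
    have hxi := inBlock_iff (x := ⟨j, hx'⟩).1 hx
    have := h (x := ⟨j, hx'⟩) (y := ⟨j + 1, hy'⟩) (by simp)
      (hxi.trans (inBlock_iff (x := ⟨j + 1, hy'⟩).1 hy).symm)
    rw [hxi] at this
    simpa only [appl, hx', hy', dif_pos, Fin.val_fin_lt] using this

lemma numDer_eq_ncard :
    numDer k a S = (wordsAvoiding S univ (colorCount (blockIndex a) univ)).ncard := by
  rw [← ncard_isClassMonotone S monotone_blockIndex, numDer]
  simp_rw [isASPerm_iff]
  rfl

lemma smallCycles_eq : smallCycles a π = monochromaticCycles (blockIndex a) π := by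
  simp only [smallCycles, monochromaticCycles, inBlock_iff]
  congr

lemma cSWeight_eq_sum : (cSWeight a S π : ℤ) =
    ∑ B with IsColorStable (blockIndex a) π B, stableWeight S (blockIndex a) π B := by
  rw [sum_stableWeight, cSWeight, smallCycles_eq]
  simp only [inBlock_iff]
  split_ifs <;> simp

end Blocks

/-- The number of `(a₁,…,a_k,S)`-derangements equals
`(1/(a₁!⋯a_k!)) ∑_{π ∈ S_n} c_S(π)`. -/
theorem numDer_eq_cSWeight_sum (k : ℕ) (a : Fin k → ℕ) (S : Finset (Fin k)) :
    (numDer k a S : ℚ) =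
      (∏ i, ((a i).factorial : ℚ))⁻¹ *
        ∑ π : Equiv.Perm (Fin (∑ t, a t)), (cSWeight a S π : ℚ) := by
  have h := sum_perm_sum_stableWeight S (blockIndex a)
  simp only [colorCount_blockIndex, ← cSWeight_eq_sum] at h
  rw [numDer_eq_ncard, ← h]
  push_cast
  rfl
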